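/- arXiv:2602.23207 — 3 statements merged into one kernel-verified Lean document; each statement's English description precedes it below -/
import Mathlib

section
/- Let x be a vector in the James Tree space JT. If ‖x‖_{JT} = ‖x‖₂ (the ℓ₂ norm of x), then x is an extreme point of the ball of radius ‖x‖_{JT}. -/
/-! Common framework for the James Tree space `JT`.

The dyadic tree is modelled as `List Bool`, ordered by `List.IsPrefix` (`<+:`). -/

abbrev DyadicNode := List Bool

namespace JTSpace

/-- A segment of the dyadic tree: a linearly ordered, order-convex subset. -/
def IsSegment (S : Set DyadicNode) : Prop :=
  (∀ a ∈ S, ∀ b ∈ S, a <+: b ∨ b <+: a) ∧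
  (∀ a ∈ S, ∀ b ∈ S, ∀ c : DyadicNode, a <+: c → c <+: b → c ∈ S)

/-- A partition: a family of pairwise disjoint segments. -/
def IsPartition (P : Set (Set DyadicNode)) : Prop :=
  (∀ S ∈ P, IsSegment S) ∧ P.PairwiseDisjoint id

/-- The sum of `x` along a set of nodes. -/
noncomputable def segSum (x : DyadicNode → ℝ) (S : Set DyadicNode) : ℝ :=
  ∑' a : S, x a

/-- The square of the value `‖x‖_P` of `x` on the partition `P`. -/
noncomputable def pNormSq (x : DyadicNode → ℝ) (P : Set (Set DyadicNode)) : ℝ :=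
  ∑' S : P, (segSum x S) ^ 2

/-- The set of all values `‖x‖_P²` over partitions `P`. -/
def normSqSet (x : DyadicNode → ℝ) : Set ℝ :=
  {r | ∃ P, IsPartition P ∧ r = pNormSq x P}

/-- The square of the `JT` norm. -/
noncomputable def JTnormSq (x : DyadicNode → ℝ) : ℝ := sSup (normSqSet x)

/-- The `JT` norm of `x`. -/
noncomputable def JTnorm (x : DyadicNode → ℝ) : ℝ := Real.sqrt (JTnormSq x)

/-- The `ℓ₂` norm of `x`. -/
noncomputable def l2norm (x : DyadicNode → ℝ) : ℝ := Real.sqrt (∑' a, (x a) ^ 2)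

def HasBddNorm (x : DyadicNode → ℝ) : Prop := BddAbove (normSqSet x)

/-- `x` belongs to the James Tree space: its norm is finite and it is approximable in the
`JT` norm by finitely supported functions (`JT` is the completion of `c₀₀(T)`). -/
def MemJT (x : DyadicNode → ℝ) : Prop :=
  HasBddNorm x ∧
  ∀ ε > (0 : ℝ), ∃ y : DyadicNode → ℝ, (Function.support y).Finite ∧
    HasBddNorm (x - y) ∧ JTnorm (x - y) ≤ ε

/-- An `x`-norming partition. -/
def IsNormingPartition (x : DyadicNode → ℝ) (P : Set (Set DyadicNode)) : Prop :=
  IsPartition P ∧ pNormSq x P = JTnormSq x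

/-- A complete subtree of the dyadic tree. -/
def IsCompleteSubtree (K : Set DyadicNode) : Prop :=
  ∀ a ∈ K, ∀ b ∈ K, ∀ c : DyadicNode, a <+: c → c <+: b → c ∈ K

/-- The range of `x`: the smallest complete subtree containing the support of `x`. -/
def ran (x : DyadicNode → ℝ) : Set DyadicNode :=
  ⋂₀ {K | IsCompleteSubtree K ∧ Function.support x ⊆ K}

/-- `x` is separated: every two distinct nodes of `ran x` are separated by some
`x`-norming partition. -/
def Separated (x : DyadicNode → ℝ) : Prop :=
  ∀ a ∈ ran x, ∀ b ∈ ran x, a ≠ b →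
    ∃ P, IsNormingPartition x P ∧ ∃ S ∈ P, ∃ S' ∈ P, S ≠ S' ∧ a ∈ S ∧ b ∈ S'

/-- `x` is an extreme point of the ball of radius `‖x‖_{JT}`. -/
def IsExtremePoint (x : DyadicNode → ℝ) : Prop :=
  x ≠ 0 ∧
  ∀ y z : DyadicNode → ℝ, MemJT y → MemJT z →
    ∀ l : ℝ, 0 < l → l < 1 → x = l • y + (1 - l) • z →
      JTnorm y = JTnorm x → JTnorm z = JTnorm x → y = x ∧ z = x

/-- A branch: a maximal segment. -/
def IsBranch (b : Set DyadicNode) : Prop :=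
  IsSegment b ∧ ∀ S : Set DyadicNode, IsSegment S → b ⊆ S → S = b

/-- The wedge rooted at `a`. -/
def wedge (a : DyadicNode) : Set DyadicNode := {b | a <+: b}

/-- The two children of a node. -/
def children (u : DyadicNode) : Set DyadicNode := {u ++ [false], u ++ [true]}

/-- The maximal segment sum starting at `a`:
`S_a(x) = sup { S_s(x) : s a segment with min s = a }`. -/
noncomputable def maxSum (x : DyadicNode → ℝ) (a : DyadicNode) : ℝ :=
  sSup {r | ∃ s : Set DyadicNode, IsSegment s ∧ a ∈ s ∧ (∀ b ∈ s, a <+: b) ∧ r = segSum x s}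

/-- The children of `u` within the subtree spanned by the support of `x`. -/
def supportedChildren (x : DyadicNode → ℝ) (u : DyadicNode) : Set DyadicNode :=
  {c ∈ children u | ∃ b ∈ Function.support x, c <+: b}

/-- A greedy partition for a positive vector `x`: a partition whose segments cover the
support of `x` and such that every segment, at every support node `u` which has a strict
descendant in the support, continues through a child of `u` (within the subtree spanned by
the support) maximizing the maximal segment sum, down to the next element of the support;
at support nodes with no strict descendant in the support, the segment's support ends. -/
def IsGreedyPartition (x : DyadicNode → ℝ) (P : Set (Set DyadicNode)) : Prop :=
  IsPartition P ∧ Function.support x ⊆ ⋃₀ P ∧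
  ∀ s ∈ P, ∀ u ∈ s ∩ Function.support x,
    ((∃ w ∈ Function.support x, u <+: w ∧ u ≠ w) →
      ∃ v ∈ s ∩ Function.support x, u <+: v ∧ u ≠ v ∧
        (∀ w ∈ s ∩ Function.support x, u <+: w → u ≠ w → v <+: w) ∧
        ∃ c ∈ supportedChildren x u, c <+: v ∧
          ∀ k ∈ supportedChildren x u, maxSum x k ≤ maxSum x c) ∧
    ((¬ ∃ w ∈ Function.support x, u <+: w ∧ u ≠ w) →
      ∀ w ∈ s ∩ Function.support x, w <+: u)


theorem sum_sq_le_JTnormSq (x : DyadicNode → ℝ) (hx : HasBddNorm x) (F : Finset DyadicNode) :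
    ∑ a ∈ F, (x a) ^ 2 ≤ JTnormSq x := by
  apply le_csSup hx
  refine ⟨(fun a => ({a} : Set DyadicNode)) '' (F : Set DyadicNode), ⟨?_, ?_⟩, ?_⟩
  · rintro S ⟨a, -, rfl⟩
    constructor
    · rintro b rfl c rfl
      exact Or.inl List.prefix_rfl
    · rintro b rfl d rfl c h1 h2
      exact List.IsPrefix.eq_of_length h2 (le_antisymm h2.length_le h1.length_le)
  · rintro S ⟨a, -, rfl⟩ T ⟨b, -, rfl⟩ hne
    simp only [Function.onFun, id, Set.disjoint_singleton]
    rintro rfl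
    exact hne rfl
  · unfold pNormSq
    rw [tsum_image (fun S => (segSum x S) ^ 2)
      (Set.singleton_injective.injOn)]
    have : ∀ a : DyadicNode, segSum x {a} = x a := fun a => tsum_singleton a x
    simp only [this]
    exact (Finset.tsum_subtype' F (fun a => (x a) ^ 2)).symm

theorem sq_summable (x : DyadicNode → ℝ) (hx : HasBddNorm x) :
    Summable (fun a => (x a) ^ 2) :=
  summable_of_sum_le (fun a => sq_nonneg (x a)) (sum_sq_le_JTnormSq x hx)

theorem tsum_sq_le (x : DyadicNode → ℝ) (hx : HasBddNorm x) :
    ∑' a, (x a) ^ 2 ≤ JTnormSq x :=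
  (sq_summable x hx).tsum_le_of_sum_le (sum_sq_le_JTnormSq x hx)

theorem JTnormSq_nonneg (x : DyadicNode → ℝ) (hx : HasBddNorm x) : 0 ≤ JTnormSq x := by
  simpa using sum_sq_le_JTnormSq x hx ∅

/-- If `x ∈ JT` satisfies `‖x‖_{JT} = ‖x‖₂`, then `x` is an extreme point
of the ball of radius `‖x‖_{JT}`. -/
theorem l2_norm_extreme (x : DyadicNode → ℝ) (hx : MemJT x) (hx0 : x ≠ 0)
    (h : JTnorm x = l2norm x) : IsExtremePoint x := by
  refine ⟨hx0, ?_⟩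
  intro y z hy hz l hl0 hl1 hxyz hny hnz
  have nx := JTnormSq_nonneg x hx.1
  have e0 : JTnormSq x = ∑' a, (x a) ^ 2 :=
    (Real.sqrt_inj nx (tsum_nonneg fun a => sq_nonneg (x a))).1 h
  have ey : JTnormSq y = JTnormSq x := (Real.sqrt_inj (JTnormSq_nonneg y hy.1) nx).1 hny
  have ez : JTnormSq z = JTnormSq x := (Real.sqrt_inj (JTnormSq_nonneg z hz.1) nx).1 hnz
  have ly := tsum_sq_le y hy.1
  have lz := tsum_sq_le z hz.1
  have sx := sq_summable x hx.1
  have sy := sq_summable y hy.1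
  have sz := sq_summable z hz.1
  have hpt : ∀ a, x a = l * y a + (1 - l) * z a := fun a => by
    have := congrFun hxyz a
    simpa using this
  have key : ∀ a, l * (1 - l) * (y a - z a) ^ 2
      = l * (y a) ^ 2 + (1 - l) * (z a) ^ 2 - (x a) ^ 2 := fun a => by
    rw [hpt a]; ring
  have hs : HasSum (fun a => l * (1 - l) * (y a - z a) ^ 2)
      (l * (∑' a, (y a) ^ 2) + (1 - l) * (∑' a, (z a) ^ 2) - ∑' a, (x a) ^ 2) := by
    simp only [key]
    exact ((sy.hasSum.mul_left l).add (sz.hasSum.mul_left (1 - l))).sub sx.hasSum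
  have hl : 0 < l * (1 - l) := mul_pos hl0 (by linarith)
  have hyz : ∀ a, y a = z a := fun a => by
    have h1 := le_hasSum hs a (fun b _ => mul_nonneg hl.le (sq_nonneg _))
    have h2 : l * (1 - l) * (y a - z a) ^ 2 ≤ 0 := by
      nlinarith
    have h3 : (y a - z a) ^ 2 = 0 :=
      le_antisymm (by by_contra hc; push Not at hc; nlinarith [mul_pos hl hc]) (sq_nonneg _)
    exact sub_eq_zero.1 (pow_eq_zero_iff (two_ne_zero) |>.1 h3)
  constructor
  · funext a
    rw [hpt a, ← hyz a]; ring
  · funext a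
    rw [hpt a, hyz a]; ring

end JTSpace
end

section
/- Let x be a vector in the James Tree space JT such that for every node a ∈ supp(x) the singleton {a} is a segment belonging to some x-norming partition. Then ‖x‖_{JT} = ‖x‖₂. -/
namespace JTSpace

/-- Finite sums of squared segment sums. -/
noncomputable def fSum (x : DyadicNode → ℝ) (F : Finset (Set DyadicNode)) : ℝ :=
  ∑ S ∈ F, (segSum x S) ^ 2

/-- Values of finite partitions inside `K`. -/
def locSet (x : DyadicNode → ℝ) (K : Set DyadicNode) : Set ℝ :=
  {r | ∃ F : Finset (Set DyadicNode), IsPartition (F : Set (Set DyadicNode)) ∧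
    (∀ S ∈ F, S ⊆ K) ∧ r = fSum x F}

/-- Squared norm of the restriction of `x` to `K`. -/
noncomputable def loc (x : DyadicNode → ℝ) (K : Set DyadicNode) : ℝ := sSup (locSet x K)

theorem pNormSq_coe (x : DyadicNode → ℝ) (F : Finset (Set DyadicNode)) :
    pNormSq x (F : Set (Set DyadicNode)) = fSum x F := by
  unfold pNormSq fSum
  exact Finset.tsum_subtype' F (fun S => segSum x S ^ 2)

theorem fSum_le {x : DyadicNode → ℝ} (hb : HasBddNorm x) {F : Finset (Set DyadicNode)}
    (hF : IsPartition (F : Set (Set DyadicNode))) : fSum x F ≤ JTnormSq x :=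
  le_csSup hb ⟨_, hF, (pNormSq_coe x F).symm⟩

theorem locSet_bdd {x : DyadicNode → ℝ} (hb : HasBddNorm x) (K : Set DyadicNode) :
    BddAbove (locSet x K) := by
  refine ⟨JTnormSq x, ?_⟩
  rintro r ⟨F, hF, -, rfl⟩
  exact fSum_le hb hF

theorem isPartition_empty : IsPartition ((∅ : Finset (Set DyadicNode)) : Set (Set DyadicNode)) := by
  constructor <;> simp

theorem locSet_nonempty (x : DyadicNode → ℝ) (K : Set DyadicNode) : (locSet x K).Nonempty :=
  ⟨_, ∅, isPartition_empty, by simp, rfl⟩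

theorem fSum_le_loc {x : DyadicNode → ℝ} (hb : HasBddNorm x) {F : Finset (Set DyadicNode)}
    {K : Set DyadicNode}
    (hF : IsPartition (F : Set (Set DyadicNode))) (hK : ∀ S ∈ F, S ⊆ K) : fSum x F ≤ loc x K :=
  le_csSup (locSet_bdd hb K) ⟨F, hF, hK, rfl⟩

theorem loc_le {x : DyadicNode → ℝ} {K : Set DyadicNode} {c : ℝ}
    (h : ∀ F : Finset (Set DyadicNode), IsPartition (F : Set (Set DyadicNode)) →
      (∀ S ∈ F, S ⊆ K) → fSum x F ≤ c) : loc x K ≤ c := by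
  refine csSup_le (locSet_nonempty x K) ?_
  rintro r ⟨F, hF, hK, rfl⟩
  exact h F hF hK

theorem fSum_nonneg (x : DyadicNode → ℝ) (F : Finset (Set DyadicNode)) : 0 ≤ fSum x F :=
  Finset.sum_nonneg fun _ _ => sq_nonneg _

theorem loc_nonneg {x : DyadicNode → ℝ} (hb : HasBddNorm x) (K : Set DyadicNode) :
    0 ≤ loc x K :=
  (fSum_nonneg x ∅).trans (fSum_le_loc hb isPartition_empty (by simp))

theorem IsPartition.mono {P Q : Set (Set DyadicNode)} (hP : IsPartition P) (h : Q ⊆ P) :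
    IsPartition Q :=
  ⟨fun S hS => hP.1 S (h hS), hP.2.subset h⟩

theorem pNormSq_le {x : DyadicNode → ℝ} {P : Set (Set DyadicNode)} {c : ℝ}
    (h : ∀ F : Finset (Set DyadicNode), (F : Set (Set DyadicNode)) ⊆ P → fSum x F ≤ c) :
    pNormSq x P ≤ c := by
  unfold pNormSq
  refine Real.tsum_le_of_sum_le (fun _ => sq_nonneg _) ?_
  intro s
  have := h (s.map (Function.Embedding.subtype _)) (by
    intro S hS
    simp at hS
    exact hS.1)
  simpa [fSum] using this

theorem segSum_empty (x : DyadicNode → ℝ) : segSum x ∅ = 0 := by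
  simp [segSum]

/-- Superadditivity. -/
theorem loc_add_le {x : DyadicNode → ℝ} (hb : HasBddNorm x) {K L M : Set DyadicNode}
    (hd : Disjoint K L) (hK : K ⊆ M) (hL : L ⊆ M) : loc x K + loc x L ≤ loc x M := by
  classical
  have key : ∀ F : Finset (Set DyadicNode), IsPartition (F : Set (Set DyadicNode)) →
      (∀ S ∈ F, S ⊆ K) → ∀ G : Finset (Set DyadicNode), IsPartition (G : Set (Set DyadicNode)) →
      (∀ S ∈ G, S ⊆ L) → fSum x F + fSum x G ≤ loc x M := by
    intro F hF hFK G hG hGL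
    have h0 : ∑ S ∈ F ∩ G, segSum x S ^ 2 = 0 := by
      refine Finset.sum_eq_zero fun S hS => ?_
      rw [Finset.mem_inter] at hS
      have : S = ∅ := by
        have := hd.mono (hFK S hS.1) (hGL S hS.2)
        simpa using this
      rw [this, segSum_empty]; norm_num
    have h1 := Finset.sum_union_inter (s₁ := F) (s₂ := G) (f := fun S => segSum x S ^ 2)
    have h2 : fSum x (F ∪ G) ≤ loc x M := by
      refine fSum_le_loc hb ⟨?_, ?_⟩ ?_
      · intro S hS
        rw [Finset.mem_coe, Finset.mem_union] at hS
        exact hS.elim (fun h => hF.1 S h) (fun h => hG.1 S h)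
      · intro S hS S' hS' hne
        rw [Finset.mem_coe, Finset.mem_union] at hS hS'
        rcases hS with hS | hS <;> rcases hS' with hS' | hS'
        · exact hF.2 hS hS' hne
        · exact hd.mono (hFK S hS) (hGL S' hS')
        · exact (hd.mono (hFK S' hS') (hGL S hS)).symm
        · exact hG.2 hS hS' hne
      · intro S hS
        rw [Finset.mem_union] at hS
        exact hS.elim (fun h => (hFK S h).trans hK) (fun h => (hGL S h).trans hL)
    unfold fSum at *
    linarith
  have h1 : loc x K ≤ loc x M - loc x L := by
    refine loc_le fun F hF hFK => ?_
    have : loc x L ≤ loc x M - fSum x F := by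
      refine loc_le fun G hG hGL => ?_
      linarith [key F hF hFK G hG hGL]
    linarith
  linarith

/-- Splitting a finite partition. -/
theorem fSum_split {x : DyadicNode → ℝ} (hb : HasBddNorm x) {K L : Set DyadicNode} {c : ℝ}
    {F : Finset (Set DyadicNode)} (hF : IsPartition (F : Set (Set DyadicNode)))
    (h : ∀ S ∈ F, S ⊆ K ∨ S ⊆ L)
    (hc : ∀ G : Finset (Set DyadicNode), IsPartition (G : Set (Set DyadicNode)) → G ⊆ F →
      (∀ S ∈ G, S ⊆ L) → fSum x G ≤ c) :
    fSum x F ≤ loc x K + c := by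
  classical
  have h1 := Finset.sum_filter_add_sum_filter_not F (fun S => S ⊆ K) (fun S => segSum x S ^ 2)
  have h2 : fSum x (F.filter (fun S => S ⊆ K)) ≤ loc x K := by
    refine fSum_le_loc hb (hF.mono ?_) ?_
    · exact_mod_cast Finset.filter_subset _ _
    · intro S hS; exact (Finset.mem_filter.1 hS).2
  have h3 : fSum x (F.filter (fun S => ¬ S ⊆ K)) ≤ c := by
    refine hc _ (hF.mono ?_) (Finset.filter_subset _ _) ?_
    · exact_mod_cast Finset.filter_subset _ _
    · intro S hS
      rw [Finset.mem_filter] at hS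
      exact (h S hS.1).resolve_left hS.2
  unfold fSum at *
  linarith

theorem wedge_cases {a b : DyadicNode} (h : b ∈ wedge a) :
    b = a ∨ b ∈ wedge (a ++ [false]) ∨ b ∈ wedge (a ++ [true]) := by
  obtain ⟨t, rfl⟩ := h
  cases t with
  | nil => left; simp
  | cons c t =>
    right
    cases c
    · left; exact ⟨t, by simp⟩
    · right; exact ⟨t, by simp⟩

theorem child_disjoint (a : DyadicNode) :
    Disjoint (wedge (a ++ [false])) (wedge (a ++ [true])) := by
  rw [Set.disjoint_left]
  rintro b ⟨s, rfl⟩ ⟨t, ht⟩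
  simp at ht

theorem child_subset (a : DyadicNode) (c : Bool) : wedge (a ++ [c]) ⊆ wedge a :=
  fun _ hb => (List.prefix_append a [c]).trans hb

theorem self_notMem_child (a : DyadicNode) (c : Bool) : a ∉ wedge (a ++ [c]) := by
  intro h
  have := List.IsPrefix.length_le h
  simp at this

/-- A segment in the wedge of `a` missing `a` lies under one child. -/
theorem seg_child {a : DyadicNode} {S : Set DyadicNode} (hS : IsSegment S) (hw : S ⊆ wedge a)
    (ha : a ∉ S) : S ⊆ wedge (a ++ [false]) ∨ S ⊆ wedge (a ++ [true]) := by
  have hc : ∀ b ∈ S, b ∈ wedge (a ++ [false]) ∨ b ∈ wedge (a ++ [true]) := by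
    intro b hb
    rcases wedge_cases (hw hb) with h | h
    · exact absurd (h ▸ hb) ha
    · exact h
  by_contra hcon
  rw [not_or, Set.not_subset, Set.not_subset] at hcon
  obtain ⟨⟨b, hb, hb'⟩, c, hcS, hc'⟩ := hcon
  have h1 := (hc b hb).resolve_left hb'
  have h2 := (hc c hcS).resolve_right hc'
  have hd := Set.disjoint_left.1 (child_disjoint a)
  rcases hS.1 b hb c hcS with h | h
  · exact hd h2 (List.IsPrefix.trans h1 h)
  · exact hd (List.IsPrefix.trans h2 h) h1

/-- A segment missing `a` lies in or out of the wedge of `a`. -/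
theorem seg_wedge {a : DyadicNode} {S : Set DyadicNode} (hS : IsSegment S)
    (ha : a ∉ S) : S ⊆ (wedge a)ᶜ ∨ S ⊆ wedge a := by
  by_contra hcon
  rw [not_or, Set.not_subset, Set.not_subset] at hcon
  obtain ⟨⟨b, hb, hb'⟩, c, hcS, hc'⟩ := hcon
  have hab : a <+: b := by simpa [wedge] using hb'
  have hac : ¬ a <+: c := hc'
  have hcb : c <+: b := by
    rcases hS.1 b hb c hcS with h | h
    · exact absurd (hab.trans h) hac
    · exact h
  have hca : c <+: a := (List.prefix_or_prefix_of_prefix hcb hab).resolve_right hac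
  exact ha (hS.2 c hcS b hb a hca hab)

/-- Finite partitions under `a` missing `a`. -/
theorem fSum_children {x : DyadicNode → ℝ} (hb : HasBddNorm x) {a : DyadicNode}
    {F : Finset (Set DyadicNode)} (hF : IsPartition (F : Set (Set DyadicNode)))
    (hw : ∀ S ∈ F, S ⊆ wedge a) (ha : ∀ S ∈ F, a ∉ S) :
    fSum x F ≤ loc x (wedge (a ++ [false])) + loc x (wedge (a ++ [true])) :=
  fSum_split hb hF (fun S hS => seg_child (hF.1 S hS) (hw S hS) (ha S hS))
    (fun _ hG _ hGL => fSum_le_loc hb hG hGL)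

theorem segSum_diff {x : DyadicNode → ℝ} {a : DyadicNode} (ha : x a = 0) (S : Set DyadicNode) :
    segSum x (S \ {a}) = segSum x S := by
  unfold segSum
  rw [tsum_subtype, tsum_subtype]
  refine tsum_congr fun b => ?_
  by_cases hba : b = a
  · subst hba; simp [Set.indicator, ha]
  · by_cases hbS : b ∈ S <;> simp [Set.indicator, hba, hbS]

theorem segSum_singleton (x : DyadicNode → ℝ) (a : DyadicNode) : segSum x {a} = x a := by
  unfold segSum
  exact tsum_singleton a x

theorem seg_diff {a : DyadicNode} {S : Set DyadicNode} (hS : IsSegment S) (hw : S ⊆ wedge a) :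
    IsSegment (S \ {a}) := by
  refine ⟨fun b hb c hc => hS.1 b hb.1 c hc.1, ?_⟩
  intro b hb c hc d hbd hdc
  refine ⟨hS.2 b hb.1 c hc.1 d hbd hdc, ?_⟩
  rintro rfl
  have h := hw hb.1
  have h1 := List.IsPrefix.length_le h
  have h2 := List.IsPrefix.length_le hbd
  exact hb.2 (List.IsPrefix.eq_of_length hbd (by omega))

theorem loc_wedge_zero {x : DyadicNode → ℝ} (hb : HasBddNorm x) {a : DyadicNode} (ha : x a = 0) :
    loc x (wedge a) ≤ loc x (wedge (a ++ [false])) + loc x (wedge (a ++ [true])) := by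
  classical
  refine loc_le fun F hF hw => ?_
  have hsum : fSum x F = fSum x (F.image (fun S => S \ {a})) := by
    unfold fSum
    rw [Finset.sum_image_of_pairwise_eq_zero]
    · exact Finset.sum_congr rfl fun S _ => by simp only [segSum_diff ha]
    · intro S hS S' hS' hne heq
      have hd : Disjoint S S' := hF.2 hS hS' hne
      have h0 : S \ {a} = ∅ := by
        have h1 : Disjoint (S \ {a}) (S' \ {a}) := hd.mono Set.sdiff_subset Set.sdiff_subset
        have heq' : S \ {a} = S' \ {a} := heq
        rw [← heq'] at h1
        simpa using h1
      simp only [h0, segSum_empty]; norm_num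
  rw [hsum]
  refine fSum_children hb ⟨?_, ?_⟩ ?_ ?_
  · intro S hS
    rw [Finset.mem_coe, Finset.mem_image] at hS
    obtain ⟨S, hS, rfl⟩ := hS
    exact seg_diff (hF.1 S hS) (hw S hS)
  · intro S hS S' hS' hne
    rw [Finset.mem_coe, Finset.mem_image] at hS hS'
    obtain ⟨S, hS, rfl⟩ := hS
    obtain ⟨S', hS', rfl⟩ := hS'
    have hne' : S ≠ S' := by rintro rfl; exact hne rfl
    have hd : Disjoint S S' := hF.2 hS hS' hne'
    exact hd.mono Set.sdiff_subset Set.sdiff_subset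
  · intro S hS
    rw [Finset.mem_image] at hS
    obtain ⟨S, hS, rfl⟩ := hS
    exact Set.sdiff_subset.trans (hw S hS)
  · intro S hS
    rw [Finset.mem_image] at hS
    obtain ⟨S, hS, rfl⟩ := hS
    simp

theorem loc_univ {x : DyadicNode → ℝ} (hb : HasBddNorm x) (K : Set DyadicNode) :
    loc x K ≤ JTnormSq x :=
  loc_le fun _ hF _ => fSum_le hb hF

theorem le_loc_univ {x : DyadicNode → ℝ} (hb : HasBddNorm x) :
    JTnormSq x ≤ loc x Set.univ := by
  refine csSup_le ⟨_, _, isPartition_empty, rfl⟩ ?_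
  rintro r ⟨P, hP, rfl⟩
  exact pNormSq_le fun F hF => fSum_le_loc hb (hP.mono hF) (fun _ _ => Set.subset_univ _)

theorem loc_wedge_norming {x : DyadicNode → ℝ} (hb : HasBddNorm x) {a : DyadicNode}
    {P : Set (Set DyadicNode)} (hP : IsNormingPartition x P) (ha : ({a} : Set DyadicNode) ∈ P) :
    loc x (wedge a) ≤
      x a ^ 2 + (loc x (wedge (a ++ [false])) + loc x (wedge (a ++ [true]))) := by
  classical
  have h1 : loc x (wedge a) + loc x (wedge a)ᶜ ≤ JTnormSq x :=
    (loc_add_le hb disjoint_compl_right (Set.subset_univ _) (Set.subset_univ _)).trans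
      (loc_univ hb Set.univ)
  have h2 : pNormSq x P ≤ x a ^ 2 + (loc x (wedge a)ᶜ +
      (loc x (wedge (a ++ [false])) + loc x (wedge (a ++ [true])))) := by
    refine pNormSq_le fun F hF => ?_
    have hFp : IsPartition ((F.erase {a} : Finset _) : Set (Set DyadicNode)) := by
      refine hP.1.mono (Set.Subset.trans ?_ hF)
      exact_mod_cast Finset.erase_subset _ _
    have hna : ∀ S ∈ F.erase {a}, a ∉ S := by
      intro S hS haS
      rw [Finset.mem_erase] at hS
      have hd : Disjoint S {a} := hP.1.2 (hF hS.2) ha hS.1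
      exact Set.disjoint_left.1 hd haS rfl
    have h3 : fSum x (F.erase {a}) ≤ loc x (wedge a)ᶜ +
        (loc x (wedge (a ++ [false])) + loc x (wedge (a ++ [true]))) := by
      refine fSum_split hb hFp (fun S hS => seg_wedge (hFp.1 S hS) (hna S hS)) ?_
      intro G hG hGF hGL
      exact fSum_children hb hG hGL (fun S hS => hna S (hGF hS))
    have h4 : fSum x F ≤ x a ^ 2 + fSum x (F.erase {a}) := by
      by_cases hmem : ({a} : Set DyadicNode) ∈ F
      · have := Finset.add_sum_erase F (fun S => segSum x S ^ 2) hmem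
        simp only [segSum_singleton] at this
        unfold fSum
        linarith
      · rw [Finset.erase_eq_of_notMem hmem]
        linarith [sq_nonneg (x a)]
    linarith
  rw [hP.2] at h2
  linarith

theorem loc_expand {x : DyadicNode → ℝ} (hb : HasBddNorm x)
    (hs : ∀ a, loc x (wedge a) ≤
      x a ^ 2 + (loc x (wedge (a ++ [false])) + loc x (wedge (a ++ [true])))) (k : ℕ) :
    ∀ a : DyadicNode, ∃ A : Finset DyadicNode, (∀ b ∈ A, b ∈ wedge a) ∧
      loc x (wedge a) ≤ ∑ b ∈ A, x b ^ 2 + loc x (wedge a ∩ {b | a.length + k ≤ b.length}) := by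
  classical
  induction k with
  | zero =>
    intro a
    refine ⟨∅, by simp, ?_⟩
    have : wedge a ∩ {b | a.length + 0 ≤ b.length} = wedge a := by
      refine Set.inter_eq_left.2 fun b hb => ?_
      simpa using List.IsPrefix.length_le hb
    rw [this]; simp
  | succ k ih =>
    intro a
    obtain ⟨A, hA, hA'⟩ := ih (a ++ [false])
    obtain ⟨B, hB, hB'⟩ := ih (a ++ [true])
    have hAB : Disjoint A B := Finset.disjoint_left.2 fun b h1 h2 =>
      Set.disjoint_left.1 (child_disjoint a) (hA b h1) (hB b h2)
    have ha : a ∉ A ∪ B := by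
      rw [Finset.mem_union]
      rintro (h | h)
      · exact self_notMem_child a _ (hA a h)
      · exact self_notMem_child a _ (hB a h)
    refine ⟨insert a (A ∪ B), ?_, ?_⟩
    · intro b hb
      rw [Finset.mem_insert, Finset.mem_union] at hb
      rcases hb with rfl | h | h
      · exact List.prefix_rfl
      · exact child_subset a _ (hA b h)
      · exact child_subset a _ (hB b h)
    · rw [Finset.sum_insert ha, Finset.sum_union hAB]
      have hlen : ∀ c : Bool, wedge (a ++ [c]) ∩ {b | (a ++ [c]).length + k ≤ b.length} ⊆
          wedge a ∩ {b | a.length + (k + 1) ≤ b.length} := by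
        rintro c b ⟨h1, h2⟩
        refine ⟨child_subset a c h1, ?_⟩
        simp at h2 ⊢
        omega
      have := loc_add_le hb ((child_disjoint a).mono Set.inter_subset_left Set.inter_subset_left)
        (hlen false) (hlen true)
      linarith [hs a]

theorem sum_sq_le {x : DyadicNode → ℝ} (hb : HasBddNorm x) (A : Finset DyadicNode) :
    ∑ b ∈ A, x b ^ 2 ≤ JTnormSq x := by
  classical
  have h : fSum x (A.image (fun b => ({b} : Set DyadicNode))) = ∑ b ∈ A, x b ^ 2 := by
    unfold fSum
    rw [Finset.sum_image (fun _ _ _ _ h => Set.singleton_injective h)]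
    simp only [segSum_singleton]
  rw [← h]
  refine fSum_le hb ⟨?_, ?_⟩
  · intro S hS
    rw [Finset.mem_coe, Finset.mem_image] at hS
    obtain ⟨b, -, rfl⟩ := hS
    refine ⟨?_, ?_⟩
    · rintro c rfl d rfl; left; exact List.prefix_rfl
    · rintro c rfl d rfl e h1 h2
      exact List.IsPrefix.eq_of_length h2 (le_antisymm h2.length_le h1.length_le)
  · intro S hS S' hS' hne
    rw [Finset.mem_coe, Finset.mem_image] at hS hS'
    obtain ⟨b, -, rfl⟩ := hS
    obtain ⟨c, -, rfl⟩ := hS'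
    have : b ≠ c := by rintro rfl; exact hne rfl
    exact Set.disjoint_singleton.2 this

theorem loc_congr_le {x y : DyadicNode → ℝ} (hy : HasBddNorm (x - y)) {K : Set DyadicNode}
    (h : ∀ b ∈ K, y b = 0) : loc x K ≤ JTnormSq (x - y) := by
  refine loc_le fun F hF hK => ?_
  have : fSum x F = fSum (x - y) F := by
    unfold fSum
    refine Finset.sum_congr rfl fun S hS => ?_
    have : segSum x S = segSum (x - y) S := by
      unfold segSum
      refine tsum_congr fun b => ?_
      simp [h b (hK S hS b.2)]
    rw [this]
  rw [this]
  exact fSum_le hy hF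

/-- If every node of `supp x` can be isolated as a singleton segment of
some `x`-norming partition, then `‖x‖_{JT} = ‖x‖₂`. -/
theorem singleton_norming_l2 (x : DyadicNode → ℝ) (hx : MemJT x)
    (hiso : ∀ a ∈ Function.support x,
      ∃ P : Set (Set DyadicNode), IsNormingPartition x P ∧ ({a} : Set DyadicNode) ∈ P) :
    JTnorm x = l2norm x := by
  have hb := hx.1
  have hs : ∀ a, loc x (wedge a) ≤
      x a ^ 2 + (loc x (wedge (a ++ [false])) + loc x (wedge (a ++ [true]))) := by
    intro a
    by_cases ha : x a = 0
    · have := loc_wedge_zero hb ha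
      linarith [sq_nonneg (x a)]
    · obtain ⟨P, hP, haP⟩ := hiso a ha
      exact loc_wedge_norming hb hP haP
  have hsum : Summable fun a => x a ^ 2 :=
    summable_of_sum_le (fun _ => sq_nonneg _) (sum_sq_le hb)
  have hle : ∑' a, x a ^ 2 ≤ JTnormSq x :=
    Real.tsum_le_of_sum_le (fun _ => sq_nonneg _) (sum_sq_le hb)
  have hge : JTnormSq x ≤ ∑' a, x a ^ 2 := by
    refine le_of_forall_pos_le_add fun ε hε => ?_
    obtain ⟨y, hyf, hyb, hyn⟩ := hx.2 (Real.sqrt ε) (Real.sqrt_pos.2 hε)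
    have hyn' : JTnormSq (x - y) ≤ ε := (Real.sqrt_le_sqrt_iff hε.le).1 hyn
    obtain ⟨n, hn⟩ := (hyf.image List.length).bddAbove
    obtain ⟨A, -, hA⟩ := loc_expand hb hs (n + 1) []
    have h1 : wedge [] = Set.univ := by
      ext b; simp [wedge]
    have h2 : loc x (wedge [] ∩ {b | ([] : DyadicNode).length + (n + 1) ≤ b.length}) ≤ ε := by
      refine (loc_congr_le hyb ?_).trans hyn'
      rintro b ⟨-, hbl⟩
      by_contra hne
      have : b.length ≤ n := hn ⟨b, hne, rfl⟩
      simp at hbl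
      omega
    have h3 : ∑ b ∈ A, x b ^ 2 ≤ ∑' a, x a ^ 2 := hsum.sum_le_tsum A (fun _ _ => sq_nonneg _)
    have h4 := le_loc_univ hb
    rw [← h1] at h4
    linarith
  unfold JTnorm l2norm
  rw [le_antisymm hge hle]

end JTSpace
end

section
/- Let x ∈ JT be a positive vector (x ≥ 0). Then every x-norming partition is consistent with the Greedy Algorithm: for every segment s of the partition and every node u ∈ s ∩ supp(x) that is not the last element of s ∩ supp(x), if c is the child of u (within the subtree spanned by supp(x)) through which s continues, then S_c(x) = max over all children k of u of S_k(x). -/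
namespace JTSpace

section Helpers

open Classical

variable {x : DyadicNode → ℝ}

theorem fam_le (hb : HasBddNorm x) {ι : Type*} (I : Finset ι) (F : ι → Set DyadicNode)
    (hseg : ∀ i ∈ I, IsSegment (F i))
    (hdis : ∀ i ∈ I, ∀ j ∈ I, i ≠ j → Disjoint (F i) (F j)) :
    ∑ i ∈ I, (segSum x (F i)) ^ 2 ≤ JTnormSq x := by
  set J := I.filter (fun i => (F i).Nonempty) with hJ
  have hinj : Set.InjOn F J := by
    intro i hi j hj hij
    simp only [hJ, Finset.coe_filter, Set.mem_ofPred_eq] at hi hj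
    by_contra hne
    have := hdis i hi.1 j hj.1 hne
    rw [hij, disjoint_self] at this
    exact hj.2.ne_empty this
  have hpart : IsPartition (↑(J.image F) : Set (Set DyadicNode)) := by
    constructor
    · intro S hS
      simp only [Finset.coe_image, Set.mem_image, Finset.mem_coe] at hS
      obtain ⟨i, hi, rfl⟩ := hS
      exact hseg i (Finset.mem_filter.1 hi).1
    · intro S hS S' hS' hne
      simp only [Finset.coe_image, Set.mem_image, Finset.mem_coe] at hS hS'
      obtain ⟨i, hi, rfl⟩ := hS
      obtain ⟨j, hj, rfl⟩ := hS'
      exact hdis i (Finset.mem_filter.1 hi).1 j (Finset.mem_filter.1 hj).1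
        (fun h => hne (by rw [h]))
  have h1 : pNormSq x (↑(J.image F) : Set (Set DyadicNode)) ≤ JTnormSq x :=
    le_csSup hb ⟨_, hpart, rfl⟩
  refine le_trans (le_of_eq ?_) h1
  unfold pNormSq
  rw [Finset.tsum_subtype' (J.image F) (fun S => (segSum x S) ^ 2), Finset.sum_image hinj, hJ,
    Finset.sum_filter_of_ne]
  intro i _ hi
  by_contra hne
  rw [Set.not_nonempty_iff_eq_empty] at hne
  apply hi
  rw [hne]
  simp [segSum]

theorem seg_sq_le (hb : HasBddNorm x) {S : Set DyadicNode} (hS : IsSegment S) :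
    (segSum x S) ^ 2 ≤ JTnormSq x := by
  have := fam_le (x := x) hb ({()} : Finset Unit) (fun _ => S) (fun _ _ => hS)
    (fun i _ j _ h => absurd (Subsingleton.elim i j) h)
  simpa using this

theorem JT_nonneg (hb : HasBddNorm x) : 0 ≤ JTnormSq x := by
  have := fam_le (x := x) hb (∅ : Finset Unit) (fun _ => ∅) (by simp) (by simp)
  simpa using this

theorem seg_le (hb : HasBddNorm x) {S : Set DyadicNode} (hS : IsSegment S) :
    segSum x S ≤ Real.sqrt (JTnormSq x) :=
  Real.le_sqrt_of_sq_le (seg_sq_le hb hS)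

theorem prefix_of_len {a b e : DyadicNode} (ha : a <+: e) (hb : b <+: e)
    (h : a.length ≤ b.length) : a <+: b := List.prefix_of_prefix_length_le ha hb h

theorem prefix_eq_len {a b : DyadicNode} (ha : a <+: b) (h : b.length ≤ a.length) : a = b :=
  ha.eq_of_length_le h

theorem prefix_cases {a b e : DyadicNode} (ha : a <+: e) (hb : b <+: e) : a <+: b ∨ b <+: a :=
  List.prefix_or_prefix_of_prefix ha hb

theorem finite_prefixes (m : DyadicNode) : {c : DyadicNode | c <+: m}.Finite := by
  refine (m.inits.toFinset.finite_toSet).subset ?_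
  intro c hc
  simpa using hc

theorem seg_summable (hb : HasBddNorm x) (hpos : ∀ a, 0 ≤ x a) {S : Set DyadicNode}
    (hS : IsSegment S) : Summable (fun a : S => x a) := by
  refine summable_of_sum_le (c := Real.sqrt (JTnormSq x)) (fun a => hpos a) ?_
  intro u
  rcases u.eq_empty_or_nonempty with rfl | hu
  · simp
  obtain ⟨m, hm, hmax⟩ := Finset.exists_max_image u (fun a => a.1.length) hu
  have hfin : (S ∩ {c | c <+: m.1}).Finite := (finite_prefixes m.1).subset Set.inter_subset_right
  have hseg : IsSegment (S ∩ {c | c <+: m.1}) := by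
    refine ⟨fun a ha b hb => hS.1 a ha.1 b hb.1, fun a ha b hb c hac hcb =>
      ⟨hS.2 a ha.1 b hb.1 c hac hcb, hcb.trans hb.2⟩⟩
  refine le_trans ?_ (seg_le hb hseg)
  have e1 : segSum x (S ∩ {c | c <+: m.1}) = ∑ a ∈ hfin.toFinset, x a := by
    unfold segSum
    rw [← Finset.tsum_subtype' hfin.toFinset x, hfin.coe_toFinset]
  rw [e1]
  have e2 : ∑ i ∈ u, x i = ∑ i ∈ u.image Subtype.val, x i := by
    rw [Finset.sum_image]
    intro a _ b _ h
    exact Subtype.ext h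
  rw [e2]
  refine Finset.sum_le_sum_of_subset_of_nonneg ?_ (fun a _ _ => hpos a)
  intro a ha
  obtain ⟨a', ha', rfl⟩ := Finset.mem_image.1 ha
  simp only [Set.Finite.mem_toFinset, Set.mem_inter_iff, Set.mem_ofPred_eq]
  refine ⟨a'.2, ?_⟩
  rcases hS.1 a' a'.2 m m.2 with h | h
  · exact h
  · have := prefix_eq_len h (hmax a' ha')
    rw [this]

theorem segSum_nonneg (hpos : ∀ a, 0 ≤ x a) (S : Set DyadicNode) : 0 ≤ segSum x S :=
  tsum_nonneg (fun a => hpos a)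

theorem segSum_union {S S' : Set DyadicNode} (hd : Disjoint S S')
    (h1 : Summable (fun a : S => x a)) (h2 : Summable (fun a : S' => x a)) :
    segSum x (S ∪ S') = segSum x S + segSum x S' :=
  Summable.tsum_union_disjoint hd h1 h2

theorem segSum_finset (t : Finset DyadicNode) : segSum x ↑t = ∑ a ∈ t, x a :=
  Finset.tsum_subtype' t x

theorem finset_summable (t : Finset DyadicNode) : Summable (fun a : (t : Set DyadicNode) => x a) :=
  Summable.of_finite

theorem summable_mono (hpos : ∀ a, 0 ≤ x a) {S S' : Set DyadicNode} (h : S ⊆ S')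
    (h2 : Summable (fun a : S' => x a)) : Summable (fun a : S => x a) :=
  h2.comp_injective (i := Set.inclusion h) (Set.inclusion_injective h)

theorem segSum_mono (hpos : ∀ a, 0 ≤ x a) {S S' : Set DyadicNode} (h : S ⊆ S')
    (h2 : Summable (fun a : S' => x a)) : segSum x S ≤ segSum x S' :=
  Summable.tsum_le_tsum_of_inj (Set.inclusion h) (Set.inclusion_injective h)
    (fun c _ => hpos c) (fun _ => le_rfl) (summable_mono hpos h h2) h2

theorem le_maxSum (hb : HasBddNorm x) {a : DyadicNode} {s : Set DyadicNode} (hs : IsSegment s)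
    (ha : a ∈ s) (hmin : ∀ b ∈ s, a <+: b) : segSum x s ≤ maxSum x a := by
  refine le_csSup ⟨Real.sqrt (JTnormSq x), ?_⟩ ⟨s, hs, ha, hmin, rfl⟩
  rintro r ⟨s', hseg, -, -, rfl⟩
  exact seg_le hb hseg

/-- The finite interval from `c` to `e`. -/
noncomputable def ival (c e : DyadicNode) : Finset DyadicNode :=
  e.inits.toFinset.filter (fun q => c <+: q)

theorem mem_ival {c e q : DyadicNode} : q ∈ ival c e ↔ c <+: q ∧ q <+: e := by
  simp [ival, and_comm]

theorem ival_seg (c e : DyadicNode) : IsSegment (ival c e : Set DyadicNode) := by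
  constructor
  · intro a ha b hb
    exact prefix_cases (mem_ival.1 ha).2 (mem_ival.1 hb).2
  · intro a ha b hb d had hdb
    exact mem_ival.2 ⟨(mem_ival.1 ha).1.trans had, hdb.trans (mem_ival.1 hb).2⟩

theorem exists_ival (hb : HasBddNorm x) (hpos : ∀ a, 0 ≤ x a) (a : DyadicNode) {r : ℝ}
    (hr : r < maxSum x a) : ∃ e, a <+: e ∧ r < ∑ q ∈ ival a e, x q := by
  have hne : {r | ∃ s : Set DyadicNode, IsSegment s ∧ a ∈ s ∧ (∀ b ∈ s, a <+: b) ∧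
      r = segSum x s}.Nonempty := by
    refine ⟨_, (ival a a : Set DyadicNode), ival_seg a a, ?_, ?_, rfl⟩
    · exact mem_ival.2 ⟨List.prefix_rfl, List.prefix_rfl⟩
    · intro b hb
      exact (mem_ival.1 hb).1
  obtain ⟨_, ⟨s, hs, has, hmin, rfl⟩, hlt⟩ := exists_lt_of_lt_csSup hne hr
  have hsum := seg_summable hb hpos hs
  obtain ⟨u, hu⟩ := ((hsum.hasSum).eventually_const_lt hlt).exists
  obtain ⟨m, hm, hmax⟩ := Finset.exists_max_image (insert ⟨a, has⟩ u) (fun a => a.1.length)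
    ⟨_, Finset.mem_insert_self _ _⟩
  refine ⟨m, hmin m m.2, lt_of_lt_of_le hu ?_⟩
  have e2 : ∑ i ∈ u, x i = ∑ i ∈ u.image Subtype.val, x i := by
    rw [Finset.sum_image]
    intro a _ b _ h
    exact Subtype.ext h
  rw [e2]
  refine Finset.sum_le_sum_of_subset_of_nonneg ?_ (fun a _ _ => hpos a)
  intro b hb'
  obtain ⟨b', hbu, rfl⟩ := Finset.mem_image.1 hb'
  refine mem_ival.2 ⟨hmin _ b'.2, ?_⟩
  rcases hs.1 b' b'.2 m m.2 with h | h
  · exact h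
  · have := prefix_eq_len h (hmax b' (Finset.mem_insert_of_mem hbu))
    rw [this]

/-- Elements of `t` strictly after all elements of `t ∩ p`. -/
noncomputable def later (t : Finset DyadicNode) (p : Set DyadicNode) : Finset DyadicNode :=
  t.filter (fun r => ∀ q ∈ t, q ∈ p → q <+: r ∧ q ≠ r)

theorem prefix_antisymm {a b : DyadicNode} (h : a <+: b) (h' : b <+: a) : a = b :=
  prefix_eq_len h h'.length_le

/-- The combinatorial double counting estimate. -/
theorem pairs_le (hpos : ∀ a, 0 ≤ x a) (t : Finset DyadicNode) {ι : Type*} (I : Finset ι)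
    (F : ι → Set DyadicNode) (hdis : ∀ i ∈ I, ∀ j ∈ I, i ≠ j → Disjoint (F i) (F j)) :
    ∑ i ∈ I, ((∑ q ∈ t.filter (· ∈ F i), x q) ^ 2 +
      2 * (∑ q ∈ t.filter (· ∈ F i), x q) * (∑ q ∈ later t (F i), x q)) ≤
      (∑ q ∈ t, x q) ^ 2 := by
  let p : ι → Finset DyadicNode := fun i => t.filter (· ∈ F i)
  let Q : ι → Finset (DyadicNode × DyadicNode) := fun i =>
    (p i ×ˢ p i) ∪ ((p i ×ˢ later t (F i)) ∪ (later t (F i) ×ˢ p i))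
  have hpl : ∀ i, Disjoint (p i) (later t (F i)) := by
    intro i
    rw [Finset.disjoint_left]
    intro q hq hq'
    have h1 := Finset.mem_filter.1 hq
    exact ((Finset.mem_filter.1 hq').2 q h1.1 h1.2).2 rfl
  have hQ : ∀ i, ∑ z ∈ Q i, x z.1 * x z.2 = (∑ q ∈ p i, x q) ^ 2 +
      2 * (∑ q ∈ p i, x q) * (∑ q ∈ later t (F i), x q) := by
    intro i
    have hd := Finset.disjoint_left.1 (hpl i)
    rw [Finset.sum_union, Finset.sum_union, Finset.sum_product, Finset.sum_product,
      Finset.sum_product, ← Finset.sum_mul_sum, ← Finset.sum_mul_sum, ← Finset.sum_mul_sum]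
    · ring
    · rw [Finset.disjoint_left]
      rintro ⟨q, r⟩ h1 h2
      rw [Finset.mem_product] at h1 h2
      exact hd h1.1 h2.1
    · rw [Finset.disjoint_left]
      rintro ⟨q, r⟩ h1 h2
      rw [Finset.mem_union, Finset.mem_product, Finset.mem_product] at h2
      rw [Finset.mem_product] at h1
      rcases h2 with h2 | h2
      · exact hd h1.2 h2.2
      · exact hd h1.1 h2.1
  have hQd : ∀ i ∈ I, ∀ j ∈ I, i ≠ j → Disjoint (Q i) (Q j) := by
    intro i hi j hj hij
    have hd := Set.disjoint_left.1 (hdis i hi j hj hij)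
    rw [Finset.disjoint_left]
    rintro ⟨q, r⟩ h1 h2
    simp only [Q, p, later, Finset.mem_union, Finset.mem_product, Finset.mem_filter] at h1 h2
    rcases h1 with h1 | h1 | h1 <;> rcases h2 with h2 | h2 | h2
    · exact hd h1.1.2 h2.1.2
    · exact hd h1.1.2 h2.1.2
    · exact hd h1.2.2 h2.2.2
    · exact hd h1.1.2 h2.1.2
    · exact hd h1.1.2 h2.1.2
    · have a1 := h1.2.2 q h1.1.1 h1.1.2
      have a2 := h2.1.2 r h2.2.1 h2.2.2
      exact a1.2 (prefix_antisymm a1.1 a2.1)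
    · exact hd h1.2.2 h2.2.2
    · have a1 := h1.1.2 r h1.2.1 h1.2.2
      have a2 := h2.2.2 q h2.1.1 h2.1.2
      exact a1.2 (prefix_antisymm a1.1 a2.1)
    · exact hd h1.2.2 h2.2.2
  calc _ = ∑ i ∈ I, ∑ z ∈ Q i, x z.1 * x z.2 := by
        refine Finset.sum_congr rfl fun i _ => ?_
        rw [hQ i]
    _ = ∑ z ∈ I.biUnion Q, x z.1 * x z.2 := by
        rw [Finset.sum_biUnion]
        intro i hi j hj hij
        exact hQd i hi j hj hij
    _ ≤ ∑ z ∈ t ×ˢ t, x z.1 * x z.2 := by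
        refine Finset.sum_le_sum_of_subset_of_nonneg ?_
          (fun z _ _ => mul_nonneg (hpos _) (hpos _))
        intro z hz
        obtain ⟨i, _, hz⟩ := Finset.mem_biUnion.1 hz
        simp only [Q, p, later, Finset.mem_union, Finset.mem_product, Finset.mem_filter] at hz
        rw [Finset.mem_product]
        rcases hz with h | h | h <;> exact ⟨h.1.1, h.2.1⟩
    _ = _ := by
        rw [Finset.sum_product, ← Finset.sum_mul_sum, sq]

theorem parts_le (hpos : ∀ a, 0 ≤ x a) (t : Finset DyadicNode) {ι : Type*} (I : Finset ι)
    (F : ι → Set DyadicNode) (hdis : ∀ i ∈ I, ∀ j ∈ I, i ≠ j → Disjoint (F i) (F j)) :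
    ∑ i ∈ I, ∑ q ∈ t.filter (· ∈ F i), x q ≤ ∑ q ∈ t, x q := by
  rw [← Finset.sum_biUnion]
  · refine Finset.sum_le_sum_of_subset_of_nonneg ?_ (fun z _ _ => hpos _)
    intro z hz
    obtain ⟨i, _, hz⟩ := Finset.mem_biUnion.1 hz
    exact (Finset.mem_filter.1 hz).1
  · intro i hi j hj hij
    have hd := Set.disjoint_left.1 (hdis i hi j hj hij)
    change Disjoint _ _
    rw [Finset.disjoint_left]
    intro q h1 h2
    exact hd (Finset.mem_filter.1 h1).2 (Finset.mem_filter.1 h2).2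

theorem child_cases {q u : DyadicNode} {b : Bool} (h : q <+: u ++ [b]) :
    q = u ++ [b] ∨ q <+: u := by
  simpa [List.concat_eq_append] using (List.prefix_concat_iff (a := b) (l₁ := q) (l₂ := u)).1
    (by simpa using h)

theorem child_not {u : DyadicNode} {b : Bool} (h : u ++ [b] <+: u) : False := by
  have := h.length_le
  simp at this

/-- For `p` below `c` meeting the interval, tail estimate. -/
theorem tail_le (hb : HasBddNorm x) (hpos : ∀ a, 0 ≤ x a) {c e : DyadicNode} {p : Set DyadicNode}
    (hp : IsSegment p) (hpw : ∀ q ∈ p, c <+: q) (hne : ∃ q ∈ ival c e, q ∈ p) :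
    segSum x (p \ (ival c e : Set DyadicNode)) + ∑ q ∈ ival c e, x q ≤
      maxSum x c + ∑ q ∈ later (ival c e) p, x q := by
  obtain ⟨q0, hq0, hq0p⟩ := hne
  obtain ⟨m, hm, hmax⟩ := Finset.exists_max_image ((ival c e).filter (· ∈ p)) (fun a => a.length)
    ⟨q0, Finset.mem_filter.2 ⟨hq0, hq0p⟩⟩
  obtain ⟨hmt, hmp⟩ := Finset.mem_filter.1 hm
  obtain ⟨hcm, hme⟩ := mem_ival.1 hmt
  have hU : IsSegment ((ival c m : Set DyadicNode) ∪ p) := by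
    constructor
    · have key : ∀ a ∈ ival c m, ∀ b ∈ p, a <+: b ∨ b <+: a := by
        intro a ha b hb
        rcases hp.1 m hmp b hb with h | h
        · exact Or.inl ((mem_ival.1 ha).2.trans h)
        · exact prefix_cases (mem_ival.1 ha).2 h
      rintro a (ha | ha) b (hb | hb)
      · exact (ival_seg c m).1 a ha b hb
      · exact key a ha b hb
      · exact (key b hb a ha).symm
      · exact hp.1 a ha b hb
    · rintro a ha b hb d had hdb
      have hca : c <+: a := by
        rcases ha with ha | ha
        · exact (mem_ival.1 ha).1
        · exact hpw a ha
      have small : d <+: m → d ∈ (ival c m : Set DyadicNode) ∪ p := fun h =>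
        Or.inl (mem_ival.2 ⟨hca.trans had, h⟩)
      rcases hb with hb | hb
      · exact small (hdb.trans (mem_ival.1 hb).2)
      · rcases hp.1 m hmp b hb with h | h
        · rcases prefix_cases hdb h with h' | h'
          · exact small h'
          · exact Or.inr (hp.2 m hmp b hb d h' hdb)
        · exact small (hdb.trans h)
  have hsub : (ival c m : Set DyadicNode) ⊆ ival c e := by
    intro q hq
    exact mem_ival.2 ⟨(mem_ival.1 hq).1, (mem_ival.1 hq).2.trans hme⟩
  have h1 : segSum x ((ival c m : Set DyadicNode) ∪ p) ≤ maxSum x c := by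
    refine le_maxSum hb hU (Or.inl (mem_ival.2 ⟨List.prefix_rfl, hcm⟩)) ?_
    rintro b (hb | hb)
    · exact (mem_ival.1 hb).1
    · exact hpw b hb
  have h2 : segSum x ((ival c m : Set DyadicNode) ∪ (p \ (ival c e : Set DyadicNode))) ≤
      segSum x ((ival c m : Set DyadicNode) ∪ p) :=
    segSum_mono hpos (Set.union_subset_union_right _ Set.sdiff_subset) (seg_summable hb hpos hU)
  rw [segSum_union, segSum_finset] at h2
  · have h3 : ∑ q ∈ ival c e, x q ≤ ∑ q ∈ ival c m, x q + ∑ q ∈ later (ival c e) p, x q := by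
      refine le_trans (Finset.sum_le_sum_of_subset_of_nonneg
        (t := ival c m ∪ later (ival c e) p) ?_ (fun z _ _ => hpos _)) ?_
      · intro r hr
        obtain ⟨hcr, hre⟩ := mem_ival.1 hr
        by_cases hrm : r <+: m
        · exact Finset.mem_union_left _ (mem_ival.2 ⟨hcr, hrm⟩)
        · refine Finset.mem_union_right _ (Finset.mem_filter.2 ⟨hr, ?_⟩)
          intro q hq hqp
          have hmr : m <+: r := (prefix_cases hre hme).resolve_left hrm
          have hqm : q <+: m := prefix_of_len (mem_ival.1 hq).2 hme
            (hmax q (Finset.mem_filter.2 ⟨hq, hqp⟩))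
          refine ⟨hqm.trans hmr, ?_⟩
          rintro rfl
          exact hrm hqm
      · rw [← Finset.sum_union_inter]
        exact le_add_of_nonneg_right (Finset.sum_nonneg fun z _ => hpos z)
    linarith
  · rw [Set.disjoint_left]
    intro q hq hq'
    exact hq'.2 (hsub hq)
  · exact finset_summable _
  · exact summable_mono hpos Set.sdiff_subset (seg_summable hb hpos hp)

theorem main_aux (hb : HasBddNorm x) (hpos : ∀ a, 0 ≤ x a)
    (P : Set (Set DyadicNode)) (hP : IsNormingPartition x P)
    (s : Set DyadicNode) (hs : s ∈ P) (u : DyadicNode) (hus : u ∈ s) (hux : x u ≠ 0)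
    (b b' : Bool) (hbb : b ≠ b') (hc : u ++ [b] ∈ s) :
    maxSum x (u ++ [b']) ≤ maxSum x (u ++ [b]) := by
  by_contra hlt
  push Not at hlt
  obtain ⟨⟨hPseg, hPdis⟩, hPn⟩ := hP
  have hsseg := hPseg s hs
  set c := u ++ [b] with hcdef
  set c' := u ++ [b'] with hcdef'
  have huc : u <+: c := List.prefix_append _ _
  have huc' : u <+: c' := List.prefix_append _ _
  have hcc' : ∀ q, c <+: q → c' <+: q → False := by
    intro q h1 h2
    have h3 : c <+: c' := prefix_of_len h1 h2 (by simp [hcdef, hcdef'])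
    have h4 : c = c' := prefix_eq_len h3 (by simp [hcdef, hcdef'])
    simp [hcdef, hcdef'] at h4
    exact hbb h4
  have hdisj : ∀ p ∈ P, ∀ p' ∈ P, p ≠ p' → ∀ q, q ∈ p → q ∈ p' → False := by
    intro p hp p' hp' hne q h1 h2
    exact Set.disjoint_left.1 (hPdis hp hp' hne) h1 h2
  -- the pieces of `s`
  set s1 : Set DyadicNode := {q ∈ s | q <+: u} with hs1
  set s2 : Set DyadicNode := {q ∈ s | c <+: q} with hs2
  have hs1sum : Summable (fun a : s1 => x a) :=
    summable_mono hpos (fun q hq => hq.1) (seg_summable hb hpos hsseg)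
  have hs2sum : Summable (fun a : s2 => x a) :=
    summable_mono hpos (fun q hq => hq.1) (seg_summable hb hpos hsseg)
  have hs12 : Disjoint s1 s2 := by
    rw [Set.disjoint_left]
    intro q h1 h2
    exact child_not (h2.2.trans h1.2)
  have hsun : s = s1 ∪ s2 := by
    ext q
    constructor
    · intro hq
      rcases hsseg.1 q hq c hc with h | h
      · rcases child_cases h with h' | h'
        · exact Or.inr ⟨hq, by rw [h']⟩
        · exact Or.inl ⟨hq, h'⟩
      · exact Or.inr ⟨hq, h⟩
    · rintro (h | h) <;> exact h.1
  have hs2seg : IsSegment s2 := ⟨fun a ha d hd => hsseg.1 a ha.1 d hd.1,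
    fun a ha d hd e h1 h2 => ⟨hsseg.2 a ha.1 d hd.1 e h1 h2, ha.2.trans h1⟩⟩
  set A := segSum x s1 with hA
  set B := segSum x s2 with hB
  have hsAB : segSum x s = A + B := by
    conv_lhs => rw [hsun]
    exact segSum_union hs12 hs1sum hs2sum
  have hApos : 0 < A := by
    have h1 : segSum x (({u} : Finset DyadicNode) : Set DyadicNode) ≤ A := by
      refine segSum_mono hpos ?_ hs1sum
      intro q hq
      simp only [Finset.coe_singleton, Set.mem_singleton_iff] at hq
      subst hq
      exact ⟨hus, List.prefix_rfl⟩
    rw [segSum_finset, Finset.sum_singleton] at h1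
    exact lt_of_lt_of_le (lt_of_le_of_ne (hpos u) (Ne.symm hux)) h1
  have hBle : B ≤ maxSum x c := le_maxSum hb hs2seg ⟨hc, List.prefix_rfl⟩ (fun q hq => hq.2)
  have hB0 : 0 ≤ B := segSum_nonneg hpos _
  set S := maxSum x c' with hS
  set ε := A * (S - B) / (2 * (S + A)) with hε
  have hSB : B < S := lt_of_le_of_lt hBle hlt
  have hεpos : 0 < ε := by
    have : 0 < S - B := by linarith
    have : 0 < S + A := by linarith
    positivity
  have hεeq : ε * (S + A) = A * (S - B) / 2 := by
    have : S + A ≠ 0 := by linarith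
    rw [hε]
    field_simp
  obtain ⟨e, hce, hTlt⟩ := exists_ival hb hpos c' (r := S - ε) (by linarith)
  set t := ival c' e with ht
  set T := ∑ q ∈ t, x q with hT
  have hTS : T ≤ S := by
    rw [hT, ← segSum_finset]
    refine le_maxSum hb (ival_seg _ _) (mem_ival.2 ⟨List.prefix_rfl, hce⟩) ?_
    intro q hq
    exact (mem_ival.1 hq).1
  have hst : Disjoint s (t : Set DyadicNode) := by
    rw [Set.disjoint_left]
    intro q hq hqt
    have hcq := (mem_ival.1 hqt).1
    rcases hsseg.1 q hq c hc with h | h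
    · exact hcc' c List.prefix_rfl (hcq.trans h)
    · exact hcc' q h hcq
  have hFseg : IsSegment (s1 ∪ (t : Set DyadicNode)) := by
    constructor
    · rintro a (ha | ha) d (hd | hd)
      · exact hsseg.1 a ha.1 d hd.1
      · exact Or.inl (ha.2.trans (huc'.trans (mem_ival.1 hd).1))
      · exact Or.inr (hd.2.trans (huc'.trans (mem_ival.1 ha).1))
      · exact (ival_seg c' e).1 a ha d hd
    · rintro a (ha | ha) d (hd | hd) f haf hfd
      · exact Or.inl ⟨hsseg.2 a ha.1 d hd.1 f haf hfd, hfd.trans hd.2⟩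
      · obtain ⟨h1, h2⟩ := mem_ival.1 hd
        have small : f <+: u → f ∈ s1 ∪ (t : Set DyadicNode) := fun h =>
          Or.inl ⟨hsseg.2 a ha.1 u hus f haf h, h⟩
        rcases prefix_cases hfd h1 with h | h
        · rcases child_cases h with h' | h'
          · exact Or.inr (mem_ival.2 ⟨by rw [h'], hfd.trans h2⟩)
          · exact small h'
        · exact Or.inr (mem_ival.2 ⟨h, hfd.trans h2⟩)
      · exact (child_not ((mem_ival.1 ha).1.trans (haf.trans (hfd.trans hd.2)))).elim
      · exact Or.inr ((ival_seg c' e).2 a ha d hd f haf hfd)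
  have hFsum : segSum x (s1 ∪ (t : Set DyadicNode)) = A + T := by
    rw [segSum_union (hst.mono_left (fun q hq => hq.1)) hs1sum (finset_summable _), segSum_finset]
  -- segments meeting `t`
  have hwedge : ∀ p ∈ P, p ≠ s → (∃ q ∈ t, q ∈ p) → ∀ r ∈ p, c' <+: r := by
    rintro p hp hps ⟨q, hqt, hqp⟩ r hr
    obtain ⟨hcq, hqe⟩ := mem_ival.1 hqt
    rcases (hPseg p hp).1 q hqp r hr with h | h
    · exact hcq.trans h
    · rcases prefix_cases h hcq with h' | h'
      · rcases child_cases h' with h'' | h''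
        · rw [h'']
        · exact (hdisj p hp s hs hps u
            ((hPseg p hp).2 r hr q hqp u h'' (huc'.trans hcq)) hus).elim
      · exact h'
  have hdseg : ∀ p ∈ P, p ≠ s → IsSegment (p \ (t : Set DyadicNode)) := by
    intro p hp hps
    refine ⟨fun a ha d hd => (hPseg p hp).1 a ha.1 d hd.1, fun a ha d hd f haf hfd => ?_⟩
    have hfp := (hPseg p hp).2 a ha.1 d hd.1 f haf hfd
    refine ⟨hfp, fun hft => ha.2 ?_⟩
    exact mem_ival.2 ⟨hwedge p hp hps ⟨f, hft, hfp⟩ a ha.1, haf.trans (mem_ival.1 hft).2⟩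
  -- estimate of a single segment
  have hsingle : ∀ p ∈ P, p ≠ s → (segSum x p) ^ 2 ≤ (segSum x (p \ (t : Set DyadicNode))) ^ 2 +
      (((∑ q ∈ t.filter (· ∈ p), x q) ^ 2 +
      2 * (∑ q ∈ t.filter (· ∈ p), x q) * (∑ q ∈ later t p, x q)) +
      2 * ε * (∑ q ∈ t.filter (· ∈ p), x q)) := by
    intro p hp hps
    have hsplit : segSum x p = ∑ q ∈ t.filter (· ∈ p), x q + segSum x (p \ (t : Set DyadicNode)) := by
      rw [← segSum_finset, ← segSum_union]
      · congr 1
        ext q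
        simp only [Set.mem_union, Finset.coe_filter, Set.mem_ofPred_eq, Set.mem_sdiff, Finset.mem_coe]
        tauto
      · rw [Set.disjoint_left]
        intro q hq hq'
        exact hq'.2 (Finset.mem_filter.1 hq).1
      · exact finset_summable _
      · exact summable_mono hpos Set.sdiff_subset (seg_summable hb hpos (hPseg p hp))
    have ha0 : 0 ≤ ∑ q ∈ t.filter (· ∈ p), x q := Finset.sum_nonneg fun z _ => hpos z
    by_cases hne : ∃ q ∈ t, q ∈ p
    · have h1 := tail_le hb hpos (hPseg p hp) (hwedge p hp hps hne) hne
      have h2 : segSum x (p \ (t : Set DyadicNode)) ≤ ε + ∑ q ∈ later t p, x q := by linarith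
      rw [hsplit]
      nlinarith [mul_le_mul_of_nonneg_left h2 ha0]
    · have : t.filter (· ∈ p) = ∅ := by
        rw [Finset.filter_eq_empty_iff]
        intro q hq hqp
        exact hne ⟨q, hq, hqp⟩
      rw [hsplit, this]
      simp
  have hsummP : Summable (fun p : P => (segSum x p) ^ 2) := by
    refine summable_of_sum_le (c := JTnormSq x) (fun _ => sq_nonneg _) fun I => ?_
    exact fam_le hb I (fun p => p.1) (fun p _ => hPseg p.1 p.2)
      (fun p _ p' _ hne => hPdis p.2 p'.2 (fun h => hne (Subtype.ext h)))
  have hfinal : JTnormSq x ≤ JTnormSq x + 2 * A * B - 2 * A * T + 2 * ε * T := by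
    conv_lhs => rw [← hPn]
    refine hsummP.tsum_le_of_sum_le fun I => ?_
    let s' : P := ⟨s, hs⟩
    set J := I.erase s' with hJ
    have hJs : ∀ p ∈ J, p.1 ≠ s := fun p hp h => (Finset.mem_erase.1 hp).1 (Subtype.ext h)
    have hne' : ∀ p p' : P, p ≠ p' → p.1 ≠ p'.1 := fun p p' h h' => h (Subtype.ext h')
    have hJdis : ∀ i ∈ J, ∀ j ∈ J, i ≠ j → Disjoint i.1 j.1 :=
      fun p _ p' _ hne => hPdis p.2 p'.2 (hne' p p' hne)
    have h1 : ∑ p ∈ I, (segSum x p) ^ 2 ≤ (A + B) ^ 2 + ∑ p ∈ J, (segSum x p) ^ 2 := by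
      have : ∑ p ∈ insert s' J, (segSum x p) ^ 2 = (A + B) ^ 2 + ∑ p ∈ J, (segSum x p) ^ 2 := by
        rw [Finset.sum_insert (Finset.notMem_erase _ _)]
        change segSum x s ^ 2 + _ = _
        rw [hsAB]
      rw [← this]
      refine Finset.sum_le_sum_of_subset_of_nonneg ?_ (fun _ _ _ => sq_nonneg _)
      intro p hp
      by_cases h : p = s'
      · exact Finset.mem_insert.2 (Or.inl h)
      · exact Finset.mem_insert_of_mem (Finset.mem_erase.2 ⟨h, hp⟩)
    have h2 := Finset.sum_le_sum (fun p (hp : p ∈ J) => hsingle p.1 p.2 (hJs p hp))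
    rw [Finset.sum_add_distrib, Finset.sum_add_distrib, ← Finset.mul_sum] at h2
    have h3 := pairs_le hpos t J (fun p => p.1) hJdis
    have h4 := parts_le hpos t J (fun p => p.1) hJdis
    have h5 := mul_le_mul_of_nonneg_left h4 (by positivity : 0 ≤ 2 * ε)
    let F : Option (Option P) → Set DyadicNode := fun o =>
      o.elim (s1 ∪ (t : Set DyadicNode)) (fun o => o.elim s2 (fun p => p.1 \ (t : Set DyadicNode)))
    have d1 : Disjoint (s1 ∪ (t : Set DyadicNode)) s2 := by
      rw [Set.disjoint_union_left]
      exact ⟨hs12, (hst.mono_left (fun q hq => hq.1)).symm⟩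
    have d2 : ∀ p ∈ J, Disjoint (s1 ∪ (t : Set DyadicNode)) (p.1 \ (t : Set DyadicNode)) := by
      intro p hp
      rw [Set.disjoint_left]
      rintro q (hq | hq) hq'
      · exact hdisj s hs p.1 p.2 (hJs p hp).symm q hq.1 hq'.1
      · exact hq'.2 hq
    have d3 : ∀ p ∈ J, Disjoint s2 (p.1 \ (t : Set DyadicNode)) := by
      intro p hp
      rw [Set.disjoint_left]
      intro q hq hq'
      exact hdisj s hs p.1 p.2 (hJs p hp).symm q hq.1 hq'.1
    have memJ : ∀ p : P, some (some p) ∈ Finset.insertNone (Finset.insertNone J) → p ∈ J :=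
      fun p hp => Finset.some_mem_insertNone.1 (Finset.some_mem_insertNone.1 hp)
    have h6 := fam_le (x := x) hb (Finset.insertNone (Finset.insertNone J)) F
      (by
        rintro (_ | _ | p) hp
        · exact hFseg
        · exact hs2seg
        · have hp : p ∈ J := memJ p hp
          exact hdseg p.1 p.2 (hJs p hp))
      (by
        rintro (_ | _ | p) hp (_ | _ | p') hp' hne
        · exact absurd rfl hne
        · exact d1
        · exact d2 p' (memJ p' hp')
        · exact d1.symm
        · exact absurd rfl hne
        · exact d3 p' (memJ p' hp')
        · exact (d2 p (memJ p hp)).symm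
        · exact (d3 p (memJ p hp)).symm
        · have hp : p ∈ J := memJ p hp
          have hp' : p' ∈ J := memJ p' hp'
          have : p ≠ p' := fun h => hne (by rw [h])
          exact (hJdis p hp p' hp' this).mono Set.sdiff_subset Set.sdiff_subset)
    rw [Finset.sum_insertNone, Finset.sum_insertNone] at h6
    simp only [F, Option.elim] at h6
    rw [hFsum] at h6
    have h7 : (A + T) ^ 2 + (B ^ 2 + ∑ p ∈ J, segSum x (p.1 \ (t : Set DyadicNode)) ^ 2)
      ≤ JTnormSq x := h6
    nlinarith
  have hTε : ε * T ≤ ε * S := mul_le_mul_of_nonneg_left hTS hεpos.le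
  have hAT : A * (S - ε) < A * T := mul_lt_mul_of_pos_left hTlt hApos
  have : 0 < A * (S - B) := mul_pos hApos (by linarith)
  nlinarith

end Helpers

/-- Every `x`-norming partition of a positive vector `x ∈ JT` is
consistent with the Greedy Algorithm: whenever a segment `s` of the partition passes
through a support node `u` which is not the last support node of `s`, and continues through
the child `c` of `u` (within the subtree spanned by the support), then `S_c(x)` equals the
maximum of `S_k(x)` over the children `k` of `u`. -/
theorem norming_consistent_with_greedy (x : DyadicNode → ℝ) (hx : MemJT x)
    (hpos : ∀ a, 0 ≤ x a)
    (P : Set (Set DyadicNode)) (hP : IsNormingPartition x P) :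
    ∀ s ∈ P, ∀ u ∈ s ∩ Function.support x,
      (∃ v ∈ s ∩ Function.support x, u <+: v ∧ u ≠ v) →
      ∀ c ∈ supportedChildren x u, c ∈ s →
        maxSum x c = max (maxSum x (u ++ [false])) (maxSum x (u ++ [true])) := by
  rintro s hs u ⟨hus, hux⟩ - c ⟨hc, -⟩ hcs
  have hc' : c = u ++ [false] ∨ c = u ++ [true] := hc
  rcases hc' with rfl | rfl
  · exact (max_eq_left (main_aux hx.1 hpos P hP s hs u hus hux false true (by simp) hcs)).symm
  · exact (max_eq_right (main_aux hx.1 hpos P hP s hs u hus hux true false (by simp) hcs)).symm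

end JTSpace
end
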